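/- Let p be a prime, q = p^r with r ≥ 1, m ≥ 2, and let f ∈ 𝔽_{q^m}(z) be a nonconstant rational function. Then #D(f) ≤ p^{e(f)}, where D(f) = { y ∈ 𝔽_q : y·f = h^p − h for some h ∈ 𝔽̄(z) } and e(f) is the p-linear degree of f. -/

import Mathlib

open Polynomial

/-- The natural embedding `RatFunc K →+* RatFunc L` induced by a field embedding `K →+* L`. -/
noncomputable def ratFuncMap {K L : Type} [Field K] [Field L] (φ : K →+* L) :
    RatFunc K →+* RatFunc L :=
  RatFunc.mapRingHom (Polynomial.mapRingHom φ) (by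
    intro q hq
    simp only [Submonoid.mem_comap, coe_mapRingHom]
    rw [mem_nonZeroDivisors_iff_ne_zero] at hq ⊢
    exact (Polynomial.map_ne_zero_iff φ.injective).mpr hq)

/-- `f` can be written as `a₀ + ∑_{i=0}^{e} aᵢ h^{pⁱ}` with top coefficient nonzero. -/
def HasPRep (p : ℕ) {K : Type} [Field K] (f : RatFunc K) (e : ℕ) : Prop :=
  ∃ (h : RatFunc K) (a₀ : K) (a : ℕ → K), a e ≠ 0 ∧
    f = RatFunc.C a₀ + ∑ i ∈ Finset.range (e + 1), RatFunc.C (a i) * h ^ p ^ i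

/-- `e` is the `p`-linear degree `e(f)` of `f`: the largest `e` such that
`f = a₀ + a₁h + a₂h^p + ⋯ + a_e h^{p^e}` with `a_e ≠ 0`. -/
def IsPLinearDegree (p : ℕ) {K : Type} [Field K] (f : RatFunc K) (e : ℕ) : Prop :=
  HasPRep p f e ∧ ∀ e' : ℕ, HasPRep p f e' → e' ≤ e

section helpers

/-- Moore-type solvability. -/
lemma aux_moore (p : ℕ) [Fact p.Prime] {K : Type} [Field K] [CharP K p] [Algebra (ZMod p) K]
    (d : ℕ) (y : Fin d → K) (hy : LinearIndependent (ZMod p) y) :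
    ∃ g : Fin d → K, ∀ k : Fin d, ∑ i, g i * y i ^ p ^ (k : ℕ) = if (k : ℕ) = 0 then 1 else 0 := by
  have hp : p.Prime := Fact.out
  let A : Matrix (Fin d) (Fin d) K := Matrix.of fun k i => y i ^ p ^ (k : ℕ)
  have hA : IsUnit A := by
    rw [← Matrix.vecMul_injective_iff_isUnit]
    have : ∀ b : Fin d → K, Matrix.vecMul b A = 0 → b = 0 := by
      intro b hb
      have hb' : ∀ i, ∑ k : Fin d, b k * y i ^ p ^ (k : ℕ) = 0 := by
        intro i
        have := congrFun hb i
        simpa [Matrix.vecMul, dotProduct, A] using this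
      let P : K[X] := ∑ k : Fin d, Polynomial.C (b k) * X ^ p ^ (k : ℕ)
      have hinj : Function.Injective (fun x : Fin d → ZMod p => ∑ i, x i • y i) := by
        intro x x' h
        have h' : ∑ i, (x i - x' i) • y i = 0 := by
          simp only [sub_smul, Finset.sum_sub_distrib]
          exact sub_eq_zero.mpr h
        funext i
        exact sub_eq_zero.mp (Fintype.linearIndependent_iff.mp hy _ h' i)
      have heval : ∀ x : Fin d → ZMod p, P.eval (∑ i, x i • y i) = 0 := by
        intro x
        simp only [P, eval_finsetSum, eval_mul, eval_C, eval_pow, eval_X]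
        have h1 : ∀ k : Fin d, (∑ i, x i • y i) ^ p ^ (k : ℕ)
            = ∑ i, x i • y i ^ p ^ (k : ℕ) := by
          intro k
          rw [sum_pow_char_pow]
          refine Finset.sum_congr rfl fun i _ => ?_
          rw [_root_.smul_pow, ZMod.pow_card_pow]
        simp only [h1, Finset.mul_sum]
        rw [Finset.sum_comm]
        refine Finset.sum_eq_zero fun i _ => ?_
        have := congrArg (fun t => x i • t) (hb' i)
        simp only [Finset.smul_sum, smul_zero] at this
        rw [← this]
        refine Finset.sum_congr rfl fun k _ => ?_
        rw [mul_smul_comm]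
      have hP : P = 0 := by
        rcases Nat.eq_zero_or_pos d with hd | hd
        · subst hd; simp [P]
        refine Polynomial.eq_zero_of_natDegree_lt_card_of_eval_eq_zero P hinj heval ?_
        have h2 : P.natDegree ≤ p ^ (d - 1) := by
          refine Polynomial.natDegree_sum_le_of_forall_le _ _ fun k _ => ?_
          refine (Polynomial.natDegree_C_mul_X_pow_le _ _).trans ?_
          exact Nat.pow_le_pow_right hp.pos (by omega)
        refine h2.trans_lt ?_
        simp only [Fintype.card_fun, ZMod.card, Fintype.card_fin]
        exact Nat.pow_lt_pow_right hp.one_lt (by omega)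
      funext k
      have := congrArg (fun q => q.coeff (p ^ (k : ℕ))) hP
      simp only [P, finsetSum_coeff, coeff_C_mul, coeff_X_pow, coeff_zero] at this
      rw [Finset.sum_eq_single k] at this
      · simpa using this
      · intro j _ hjk
        rw [if_neg, mul_zero]
        intro h
        exact hjk (Fin.ext (Nat.pow_right_injective hp.two_le h).symm)
      · simp
    intro b b' h
    have := this (b - b') (by rw [Matrix.sub_vecMul]; exact sub_eq_zero.mpr h)
    exact sub_eq_zero.mp this
  obtain ⟨g, hg⟩ := Matrix.mulVec_surjective_iff_isUnit.mpr hA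
    (fun k => if (k : ℕ) = 0 then 1 else 0)
  refine ⟨g, fun k => ?_⟩
  rw [← congrFun hg k]
  simp [Matrix.mulVec, dotProduct, A, mul_comm]

lemma aux_rel (p : ℕ) {K : Type} [Field K] (d : ℕ) (c : Fin d → K) (n : ℕ) :
    ∀ b : ℕ → K, (∃ j < n, b j ≠ 0) → (∀ i, ∑ j ∈ Finset.range n, b j * c i ^ p ^ j = 0) →
    ∃ k < n, ∃ a : ℕ → K, ∀ i, c i ^ p ^ k = ∑ j ∈ Finset.range k, a j * c i ^ p ^ j := by
  induction n with
  | zero => rintro b ⟨j, hj, _⟩; omega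
  | succ n ih =>
    rintro b ⟨j, hj, hbj⟩ hb
    by_cases h0 : b n = 0
    · obtain ⟨k, hk, h⟩ := ih b ⟨j, by
        rcases Nat.lt_succ_iff_lt_or_eq.mp hj with h | h
        · exact h
        · subst h; exact absurd h0 hbj, hbj⟩ (fun i => by
          have := hb i
          rwa [Finset.sum_range_succ, h0, zero_mul, add_zero] at this)
      exact ⟨k, by omega, h⟩
    · refine ⟨n, by omega, fun j => - b j / b n, fun i => ?_⟩
      have := hb i
      rw [Finset.sum_range_succ] at this
      have h2 : c i ^ p ^ n = -(∑ j ∈ Finset.range n, b j * c i ^ p ^ j) / b n := by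
        rw [eq_div_iff h0]; linear_combination this
      rw [h2, neg_div, Finset.sum_div, ← Finset.sum_neg_distrib]
      refine Finset.sum_congr rfl fun j _ => ?_
      ring

lemma aux_dep (p : ℕ) [Fact p.Prime] {K : Type} [Field K] [CharP K p] (d : ℕ) (c : Fin d → K) :
    ∃ a : ℕ → K, ∀ i, c i ^ p ^ d = ∑ j ∈ Finset.range d, a j * c i ^ p ^ j := by
  have hnl : ¬ LinearIndependent K (fun (j : Fin (d + 1)) (i : Fin d) => c i ^ p ^ (j : ℕ)) := by
    intro h
    have := h.fintype_card_le_finrank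
    simp at this
  rw [Fintype.not_linearIndependent_iff] at hnl
  obtain ⟨g, hg, j, hj⟩ := hnl
  obtain ⟨k, hk, hR⟩ := aux_rel p d c (d + 1) (fun j => if h : j < d + 1 then g ⟨j, h⟩ else 0)
    ⟨j, j.2, by simpa [Nat.lt_succ_iff.mp j.2] using hj⟩ (fun i => by
      rw [Finset.sum_range]
      have := congrFun hg i
      simp only [Fin.is_lt, dite_true, Fin.eta]
      simpa using this)
  have : ∀ n, k ≤ n →
      ∃ a : ℕ → K, ∀ i, c i ^ p ^ n = ∑ j ∈ Finset.range n, a j * c i ^ p ^ j := by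
    intro n hn
    induction n, hn using Nat.le_induction with
    | base => exact hR
    | succ n _ ih =>
      obtain ⟨a, ha⟩ := ih
      refine ⟨fun j => if j = 0 then 0 else a (j - 1) ^ p, fun i => ?_⟩
      rw [Finset.sum_range_succ', pow_succ p n, pow_mul, ha i, sum_pow_char]
      simp [mul_pow, pow_succ, pow_mul]
  exact this d (by omega)

/-- Main algebraic step. -/
lemma aux_main (p : ℕ) [Fact p.Prime] {K : Type} [Field K] [CharP K p] [PerfectRing K p]
    [Algebra (ZMod p) K] (d : ℕ) (hd : 0 < d) (y : Fin d → K)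
    (hy : LinearIndependent (ZMod p) y) (f : RatFunc K) (g : Fin d → RatFunc K) (κ : Fin d → K)
    (hg : ∀ i, RatFunc.C (y i) * f = g i ^ p - g i + RatFunc.C (κ i)) :
    HasPRep p f d := by
  have : CharP (RatFunc K) p := charP_of_injective_ringHom (RatFunc.C (K := K)).injective p
  obtain ⟨w, hw⟩ := aux_moore p d y hy
  have hc : ∀ i, ∃ c, c ^ p ^ d = w i := fun i => (bijective_iterateFrobenius K p d).2 (w i)
  choose c hc using hc
  have hcy : ∀ j, 1 ≤ j → j ≤ d → ∑ i, c i ^ p ^ j * y i = if j = d then 1 else 0 := by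
    intro j h1 h2
    apply (bijective_iterateFrobenius K p (d - j)).1
    simp only [iterateFrobenius_def]
    rw [sum_pow_char_pow]
    have h3 := hw ⟨d - j, by omega⟩
    simp only at h3
    have h4 : (∑ i, (c i ^ p ^ j * y i) ^ p ^ (d - j)) = ∑ i, w i * y i ^ p ^ (d - j) := by
      refine Finset.sum_congr rfl fun i _ => ?_
      rw [mul_pow, ← pow_mul, ← pow_add, ← hc]
      congr 3
      omega
    rw [h4, h3]
    by_cases h : j = d
    · subst h; simp
    · rw [if_neg (by omega), if_neg h, zero_pow]
      exact pow_ne_zero _ (Fact.out : p.Prime).ne_zero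
  set u : RatFunc K := ∑ i, RatFunc.C (c i) * g i with hu
  have hstep : ∀ j, j ≤ d → ∃ s : K, u ^ p ^ j = ∑ i, RatFunc.C (c i ^ p ^ j) * g i
      + (if j = d then f else 0) + RatFunc.C s := by
    intro j
    induction j with
    | zero => intro _; exact ⟨0, by simp [hu, hd.ne]⟩
    | succ j ih =>
      intro hj
      obtain ⟨s, hs⟩ := ih (by omega)
      rw [if_neg (by omega), add_zero] at hs
      refine ⟨s ^ p - ∑ i, c i ^ p ^ (j + 1) * κ i, ?_⟩
      rw [pow_succ p j, pow_mul, hs, add_pow_char, sum_pow_char]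
      have h1 : ∀ i, (RatFunc.C (c i ^ p ^ j) * g i) ^ p
          = RatFunc.C (c i ^ p ^ (j + 1)) * g i + RatFunc.C (c i ^ p ^ (j + 1) * y i) * f
            - RatFunc.C (c i ^ p ^ (j + 1) * κ i) := by
        intro i
        rw [mul_pow, ← map_pow, ← pow_mul, ← pow_succ, map_mul, map_mul]
        linear_combination (-RatFunc.C (c i ^ p ^ (j + 1))) * hg i
      simp only [h1, ← pow_succ]
      rw [Finset.sum_sub_distrib, Finset.sum_add_distrib, ← Finset.sum_mul, ← map_sum,
        hcy (j + 1) (by omega) hj, ← map_sum, map_sub, map_pow]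
      split_ifs <;> simp <;> ring
  choose! s hs using hstep
  obtain ⟨a, ha⟩ := aux_dep p d c
  refine ⟨u, ∑ j ∈ Finset.range d, a j * s j - s d, fun j => if j = d then 1 else - a j, by simp, ?_⟩
  rw [Finset.sum_range_succ]
  have h5 : ∑ j ∈ Finset.range d, RatFunc.C (if j = d then 1 else - a j) * u ^ p ^ j
      = - ∑ i, RatFunc.C (c i ^ p ^ d) * g i - ∑ j ∈ Finset.range d, RatFunc.C (a j * s j) := by
    have : ∀ i, RatFunc.C (c i ^ p ^ d) * g i
        = ∑ j ∈ Finset.range d, RatFunc.C (a j) * (RatFunc.C (c i ^ p ^ j) * g i) := by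
      intro i
      rw [ha i, map_sum, Finset.sum_mul]
      refine Finset.sum_congr rfl fun j _ => ?_
      rw [map_mul, mul_assoc]
    simp only [this]
    rw [Finset.sum_comm, ← Finset.sum_neg_distrib, ← Finset.sum_sub_distrib]
    refine Finset.sum_congr rfl fun j hj => ?_
    have hj := Finset.mem_range.mp hj
    rw [hs j hj.le, if_neg hj.ne, if_neg hj.ne, ← Finset.mul_sum, map_neg, map_mul]
    ring
  rw [h5, hs d le_rfl]
  simp only [if_true, map_sub, map_sum, map_one]
  ring

lemma ratFuncMap_div {K L : Type} [Field K] [Field L] (φ : K →+* L) (P Q : K[X]) :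
    ratFuncMap φ (algebraMap _ _ P / algebraMap _ _ Q)
      = algebraMap _ _ (P.map φ) / algebraMap _ _ (Q.map φ) := by
  unfold ratFuncMap
  rw [RatFunc.coe_mapRingHom_eq_coe_map, RatFunc.map_apply_div]
  rfl

lemma ratFuncMap_C {K L : Type} [Field K] [Field L] (φ : K →+* L) (a : K) :
    ratFuncMap φ (RatFunc.C a) = RatFunc.C (φ a) := by
  have := ratFuncMap_div φ (Polynomial.C a) 1
  simpa using this

lemma ratFuncMap_comp {K L M : Type} [Field K] [Field L] [Field M] (φ : K →+* L) (ψ : L →+* M)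
    (x : RatFunc K) : ratFuncMap ψ (ratFuncMap φ x) = ratFuncMap (ψ.comp φ) x := by
  rw [← RatFunc.num_div_denom x]
  simp only [ratFuncMap_div, Polynomial.map_map]

/-- A rational function fixed by `σ` has coefficients fixed by `σ`. -/
lemma aux_fixed {K L : Type} [Field K] [Field L] (φ : K →+* L) (σ : L →+* L)
    (hσ : ∀ a, σ a = a → a ∈ φ.range) (x : RatFunc L) (hx : ratFuncMap σ x = x) :
    ∃ g : RatFunc K, ratFuncMap φ g = x := by
  have h1 : algebraMap L[X] (RatFunc L) (x.num.map σ) / algebraMap _ _ (x.denom.map σ)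
      = algebraMap _ _ x.num / algebraMap _ _ x.denom := by
    rw [← ratFuncMap_div, RatFunc.num_div_denom, hx]
  have hQ0 : x.denom ≠ 0 := x.denom_ne_zero
  have hQ1 : x.denom.map σ ≠ 0 := (Polynomial.map_ne_zero_iff σ.injective).mpr hQ0
  rw [div_eq_div_iff (RatFunc.algebraMap_ne_zero hQ1) (RatFunc.algebraMap_ne_zero hQ0),
    ← map_mul, ← map_mul] at h1
  have h2 := RatFunc.algebraMap_injective L h1
  have hdvd : x.denom ∣ x.denom.map σ := by
    refine x.isCoprime_num_denom.symm.dvd_of_dvd_mul_left ?_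
    exact ⟨_, by rw [← h2, mul_comm]⟩
  have hQ : x.denom.map σ = x.denom := by
    refine (Polynomial.eq_of_monic_of_associated x.monic_denom (x.monic_denom.map σ) ?_).symm
    refine Polynomial.associated_of_dvd_of_natDegree_le hdvd hQ1 ?_
    rw [Polynomial.natDegree_map]
  have hP : x.num.map σ = x.num := by
    rw [hQ] at h2
    exact mul_right_cancel₀ hQ0 h2
  have key : ∀ P : L[X], P.map σ = P → ∃ P' : K[X], P'.map φ = P := by
    intro P hP
    rw [← Polynomial.mem_lifts, Polynomial.lifts_iff_coeff_lifts]
    intro n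
    refine hσ _ ?_
    conv_rhs => rw [← hP]
    rw [coeff_map]
  obtain ⟨P', hP'⟩ := key _ hP
  obtain ⟨Q', hQ'⟩ := key _ hQ
  refine ⟨algebraMap _ _ P' / algebraMap _ _ Q', ?_⟩
  rw [ratFuncMap_div, hP', hQ', RatFunc.num_div_denom]

/-- Descent to `K(z)` up to constants. -/
lemma aux_descent (p n : ℕ) [Fact p.Prime] {K : Type} [Field K] [Fintype K] [CharP K p]
    (hn : n ≠ 0) (hK : Fintype.card K = p ^ n) (f : RatFunc K) (h : RatFunc (AlgebraicClosure K))
    (hf : ratFuncMap (algebraMap K (AlgebraicClosure K)) f = h ^ p - h) :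
    ∃ (g : RatFunc K) (κ : K), f = g ^ p - g + RatFunc.C κ := by
  have hp : p.Prime := Fact.out
  have : CharP (AlgebraicClosure K) p :=
    charP_of_injective_ringHom (algebraMap K (AlgebraicClosure K)).injective p
  have : CharP (RatFunc (AlgebraicClosure K)) p :=
    charP_of_injective_ringHom (RatFunc.C (K := AlgebraicClosure K)).injective p
  set φ := algebraMap K (AlgebraicClosure K) with hφ
  set σ := iterateFrobenius (AlgebraicClosure K) p n with hσd
  have hσa : ∀ a, σ a = a ^ p ^ n := fun a => iterateFrobenius_def ..
  have hσφ : σ.comp φ = φ := by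
    ext a
    simp only [RingHom.comp_apply, hσa]
    rw [← map_pow, ← hK, FiniteField.pow_card]
  have hone : 1 < p ^ n := Nat.one_lt_pow hn hp.one_lt
  have hσ : ∀ a, σ a = a → a ∈ φ.range := by
    intro a ha
    by_contra hna
    have hz := Polynomial.eq_zero_of_natDegree_lt_card_of_eval_eq_zero
      (X ^ p ^ n - X : (AlgebraicClosure K)[X])
      (f := fun o : Option K => o.elim a φ) (by
        rintro (_ | x) (_ | x') hxx
        · rfl
        · exact absurd ⟨x', hxx.symm⟩ hna
        · exact absurd ⟨x, hxx⟩ hna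
        · exact congrArg some (φ.injective hxx)) (by
        rintro (_ | x)
        · simp [← hσa, ha]
        · simp [← map_pow, ← hK, FiniteField.pow_card]) (by
        rw [FiniteField.X_pow_card_sub_X_natDegree_eq _ hone, Fintype.card_option, hK]
        omega)
    exact FiniteField.X_pow_card_sub_X_ne_zero _ hone hz
  have hfix : ratFuncMap σ (h ^ p - h) = h ^ p - h := by
    rw [← hf, ratFuncMap_comp, hσφ]
  set t := ratFuncMap σ h - h with ht
  have htp : t ^ p = t := by
    rw [ht, sub_pow_char]
    rw [map_sub, map_pow] at hfix
    linear_combination hfix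
  have htC : ∃ b, t = RatFunc.C b := by
    have h1 : t ∈ (⊥ : Subfield (RatFunc (AlgebraicClosure K))) :=
      (Subfield.mem_bot_iff_pow_eq_self (RatFunc (AlgebraicClosure K)) p).mpr htp
    have h2 : (⊥ : Subfield (RatFunc (AlgebraicClosure K)))
      ≤ (RatFunc.C (K := AlgebraicClosure K)).fieldRange := bot_le
    obtain ⟨b, hb⟩ := h2 h1
    exact ⟨b, hb.symm⟩
  obtain ⟨b, hb⟩ := htC
  obtain ⟨c, hc⟩ : ∃ c : AlgebraicClosure K, c ^ p ^ n - c = b := by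
    have hdeg : (X ^ p ^ n - X - Polynomial.C b : (AlgebraicClosure K)[X]).natDegree = p ^ n := by
      rw [Polynomial.natDegree_sub_C, FiniteField.X_pow_card_sub_X_natDegree_eq _ hone]
    obtain ⟨c, hc⟩ := IsAlgClosed.exists_root
      (X ^ p ^ n - X - Polynomial.C b : (AlgebraicClosure K)[X]) (by
        intro h0
        have h00 : (X ^ p ^ n - X - Polynomial.C b : (AlgebraicClosure K)[X]).natDegree = 0 :=
          Polynomial.natDegree_eq_of_degree_eq_some h0
        omega)
    refine ⟨c, ?_⟩
    simpa [sub_eq_zero] using hc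
  obtain ⟨g, hg⟩ := aux_fixed φ σ hσ (h - RatFunc.C c) (by
    rw [map_sub, ratFuncMap_C, hσa]
    have h3 : RatFunc.C (c ^ p ^ n) - RatFunc.C c = t := by rw [hb, ← hc, map_sub]
    rw [ht] at h3
    linear_combination -h3)
  have hw : ratFuncMap φ (f - (g ^ p - g)) = RatFunc.C (c ^ p - c) := by
    rw [map_sub, map_sub, map_pow, hg, hf, sub_pow_char, map_sub, map_pow]
    ring
  have hfixc : σ (c ^ p - c) = c ^ p - c := by
    apply (RatFunc.C (K := AlgebraicClosure K)).injective
    rw [← ratFuncMap_C, ← hw, ratFuncMap_comp, hσφ]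
  obtain ⟨κ, hκ⟩ := hσ _ hfixc
  refine ⟨g, κ, ?_⟩
  have : f - (g ^ p - g) = RatFunc.C κ := by
    apply (ratFuncMap φ).injective
    rw [hw, ratFuncMap_C, hκ]
  linear_combination this

end helpers

/-- For nonconstant `f ∈ 𝔽_{q^m}(z)`, `#D(f) ≤ p^{e(f)}` where
`D(f) = {y ∈ 𝔽_q : y·f = h^p − h for some h ∈ 𝔽̄(z)}`. -/
theorem stmt_6 (p r m : ℕ) (hp : p.Prime) (hr : 1 ≤ r) (hm : 2 ≤ m)
    (F K : Type) [Field F] [Field K] [Algebra F K] [Fintype F] [Fintype K]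
    (hF : Fintype.card F = p ^ r) (hK : Fintype.card K = (p ^ r) ^ m)
    (f : RatFunc K) (hf : ∀ c : K, f ≠ RatFunc.C c)
    (e : ℕ) (he : IsPLinearDegree p f e) :
    {y : F | ∃ h : RatFunc (AlgebraicClosure K),
        ratFuncMap (algebraMap K (AlgebraicClosure K))
          (RatFunc.C (algebraMap F K y) * f) = h ^ p - h}.ncard ≤ p ^ e := by
  have : Fact p.Prime := ⟨hp⟩
  have hrm : r * m ≠ 0 := by positivity
  have : CharP F p := by
    have h := CharP.charP_iff_prime_eq_zero (R := F) hp
    rw [h]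
    have h2 := FiniteField.cast_card_eq_zero F
    rw [hF, Nat.cast_pow] at h2
    exact pow_eq_zero_iff (by omega) |>.mp h2
  have : CharP K p := charP_of_injective_ringHom (algebraMap F K).injective p
  have hKc : Fintype.card K = p ^ (r * m) := by rw [hK, pow_mul]
  have : CharP (RatFunc (AlgebraicClosure K)) p :=
    charP_of_injective_ringHom ((RatFunc.C (K := AlgebraicClosure K)).comp
      (algebraMap K (AlgebraicClosure K))).injective p
  let algF : Algebra (ZMod p) F := ZMod.algebra F p
  let algK : Algebra (ZMod p) K := ZMod.algebra K p
  set ι := ratFuncMap (algebraMap K (AlgebraicClosure K)) with hι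
  let A : AddSubgroup F :=
    { carrier := {y : F | ∃ h : RatFunc (AlgebraicClosure K),
        ι (RatFunc.C (algebraMap F K y) * f) = h ^ p - h}
      zero_mem' := ⟨0, by simp [hp.ne_zero]⟩
      add_mem' := by
        rintro a b ⟨h, hh⟩ ⟨h', hh'⟩
        refine ⟨h + h', ?_⟩
        rw [map_add, map_add, add_mul, map_add, hh, hh', add_pow_char]
        ring
      neg_mem' := by
        rintro a ⟨h, hh⟩
        refine ⟨-h, ?_⟩
        rw [map_neg, map_neg, neg_mul, map_neg, hh]
        have h0 : (h + -h) ^ p = h ^ p + (-h) ^ p := add_pow_char ..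
        rw [add_neg_cancel, zero_pow hp.ne_zero] at h0
        linear_combination h0 }
  let D : Submodule (ZMod p) F := AddSubgroup.toZModSubmodule p A
  change (D : Set F).ncard ≤ p ^ e
  set d := Module.finrank (ZMod p) D with hd
  have hcard : (D : Set F).ncard = p ^ d := by
    change Nat.card D = _
    rw [Module.natCard_eq_pow_finrank (K := ZMod p), Nat.card_zmod]
  rw [hcard]
  refine Nat.pow_le_pow_right hp.pos ?_
  rcases Nat.eq_zero_or_pos d with h0 | hpos
  · omega
  apply he.2
  let bD := Module.finBasis (ZMod p) D
  let y : Fin d → K := fun i => algebraMap F K (bD i : F)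
  have hy : LinearIndependent (ZMod p) y := by
    have h1 := bD.linearIndependent.map' D.subtype (Submodule.ker_subtype D)
    let T : F →ₗ[ZMod p] K := AddMonoidHom.toZModLinearMap p (algebraMap F K).toAddMonoidHom
    exact h1.map' T (LinearMap.ker_eq_bot.mpr (algebraMap F K).injective)
  have hh : ∀ i, ∃ (g : RatFunc K) (κ : K),
      RatFunc.C (y i) * f = g ^ p - g + RatFunc.C κ := by
    intro i
    obtain ⟨h, hh⟩ : (bD i : F) ∈ A := (bD i).2
    exact aux_descent p (r * m) hrm hKc _ h hh
  choose g κ hg using hh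
  exact aux_main p d hpos y hy f g κ hg
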